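/- arXiv:1805.05130 — 3 statements merged into one kernel-verified Lean document; each statement's English description precedes it below -/
import Mathlib

section
/- For every positive integer m, the third group cohomology of the cyclic group ℤ/mℤ with coefficients in the circle group U(1) = ℝ/ℤ (with trivial ℤ/mℤ-action) is isomorphic to ℤ/mℤ: H³(ℤ/mℤ, U(1)) ≅ ℤ/mℤ. -/
open CategoryTheory

theorem Representation.norm_trivial_apply {k G V : Type*} [CommRing k] [Group G] [Fintype G]
    [AddCommGroup V] [Module k V] (x : V) :
    (Representation.trivial k G V).norm x = Fintype.card G • x := by
  simp [Representation.norm]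

namespace Rep.FiniteCyclicGroup

universe u

variable {k G : Type u} [CommRing k] [CommGroup G] [Fintype G]
  (g : G) (hg : ∀ x, x ∈ Subgroup.zpowers g)

theorem groupCohomologyπOdd_surjective (A : Rep k G) (i : ℕ) (hi : Odd i) :
    Function.Surjective (groupCohomologyπOdd A g hg i hi) := by
  rw [← ModuleCat.epi_iff_surjective]
  exact epi_comp (ShortComplex.moduleCatCyclesIso _).inv _

variable (V : Type u) [AddCommGroup V] [Module k V]

/-- For a trivial representation `V` of a finite cyclic group `G`, the odd cohomology is the
`|G|`-torsion of `V`. -/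
noncomputable def groupCohomologyTrivialOddEquiv (i : ℕ) (hi : Odd i) :
    Submodule.torsionBy k V (Fintype.card G) ≃ₗ[k] groupCohomology (Rep.trivial k G V) i :=
  have h : LinearMap.ker (Rep.trivial k G V).norm.hom.toLinearMap =
      Submodule.torsionBy k V (Fintype.card G) := by
    ext x
    change (Representation.trivial k G V).norm x = 0 ↔ _
    rw [Representation.norm_trivial_apply, Submodule.mem_torsionBy_iff, Nat.cast_smul_eq_nsmul]
  (LinearEquiv.ofEq _ _ h.symm).trans <| LinearEquiv.ofBijective
    (groupCohomologyπOdd (Rep.trivial k G V) g hg i hi).hom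
    ⟨fun x y hxy => by
      obtain ⟨z, hz⟩ := (groupCohomologyπOdd_eq_iff _ g hg i hi x y).1 hxy
      have : (0 : V) = x.1 - y.1 := by
        rw [← hz]
        simp [Rep.sub_hom, applyAsHom]
      exact Subtype.ext (sub_eq_zero.1 this.symm), groupCohomologyπOdd_surjective g hg _ i hi⟩

end Rep.FiniteCyclicGroup

theorem AddCircle.torsionBy_eq_zmultiples {m : ℕ} (hm : 0 < m) :
    (Submodule.torsionBy ℤ (AddCircle (1 : ℝ)) m).toAddSubgroup =
      AddSubgroup.zmultiples (((1 / m : ℝ) : AddCircle (1 : ℝ))) := by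
  ext u
  simp only [Submodule.mem_toAddSubgroup, Submodule.mem_torsionBy_iff, natCast_zsmul]
  refine ⟨fun h => ?_, fun h => ?_⟩
  · obtain ⟨n, -, rfl⟩ := (AddCircle.nsmul_eq_zero_iff (p := (1 : ℝ)) hm).1 h
    rw [AddCircle.natCast_div_mul_eq_nsmul]
    exact nsmul_mem (AddSubgroup.mem_zmultiples _) n
  · obtain ⟨n, rfl⟩ := AddSubgroup.mem_zmultiples_iff.1 h
    rw [smul_comm, ← AddCircle.coe_nsmul]
    have : (m : ℝ) ≠ 0 := by positivity
    simp [this, AddCircle.coe_period]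

/-- For every positive integer `m`, the third group cohomology of `ℤ/mℤ` with
coefficients in the circle group `U(1) = ℝ/ℤ` (with trivial action) is isomorphic
to `ℤ/mℤ`. -/
theorem third_cohomology_zmod_circle (m : ℕ) (hm : 0 < m) :
    Nonempty
      ((groupCohomology
          (Rep.trivial ℤ (Multiplicative (ZMod m)) (AddCircle (1 : ℝ))) 3) ≃+
        ZMod m) := by
  have : NeZero m := ⟨hm.ne'⟩
  have hg : ∀ x : Multiplicative (ZMod m), x ∈ Subgroup.zpowers (.ofAdd 1) := fun x =>
    
    ⟨(x.toAdd.val : ℤ), Multiplicative.toAdd.injective <| by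
      simp only [zpow_natCast, toAdd_pow, toAdd_ofAdd, nsmul_one, ZMod.natCast_rightInverse _]⟩
  have e := Rep.FiniteCyclicGroup.groupCohomologyTrivialOddEquiv (k := ℤ) _ hg
    (AddCircle (1 : ℝ)) 3 (by decide)
  rw [Fintype.card_multiplicative, ZMod.card] at e
  have h : Nat.card (AddSubgroup.zmultiples (((1 / m : ℝ) : AddCircle (1 : ℝ)))) = m := by
    rw [Nat.card_zmultiples, AddCircle.addOrderOf_period_div hm]
  exact ⟨e.symm.toAddEquiv.trans <|
    (AddEquiv.addSubgroupCongr (AddCircle.torsionBy_eq_zmultiples hm)).trans <|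
    ((ZMod.ringEquivCongr h).symm.toAddEquiv.trans (zmodAddCyclicAddEquiv inferInstance)).symm⟩
end

section
/- Let α = α_5 be the cocycle α_5(g₁,g₂,g₃) = exp((2πi/25) · ḡ₁(ḡ₂ + ḡ₃ − (g₂+g₃)‾)) on ℤ/5ℤ. Then ∑_{b ∈ ℤ/5ℤ} α(b,b,b)^{−1} · α(2b,b,b) · α(3b,3b,3b) · α(b,b,3b) · α(b,2b,2b) · α(2b,3b,2b) = (1/2)(5 + √5 + i√(10+2√5)). In particular this sum is not equal to 1, so the generalized Dijkgraaf–Witten invariants Z(m003) and Z(m004) = 1 (computed with G = ℤ/5ℤ and α) are distinct. -/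
/-- The standard 3-cocycle on `ℤ/mℤ` generating `H³(ℤ/mℤ, U(1)) ≅ ℤ/mℤ`:
`α_m(g₁,g₂,g₃) = exp((2πi/m²)·ḡ₁(ḡ₂ + ḡ₃ − (g₂+g₃)‾))`, where `x̄ = x.val` is the
canonical integer representative of `x ∈ ℤ/mℤ`. -/
noncomputable def alphaZMod (m : ℕ) (g₁ g₂ g₃ : ZMod m) : ℂ :=
  Complex.exp (2 * Real.pi * Complex.I / (m : ℂ) ^ 2 *
    ((g₁.val : ℂ) * ((g₂.val : ℂ) + (g₃.val : ℂ) - ((g₂ + g₃).val : ℂ))))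

/-- `α_m` takes values in the `m`-th roots of unity; the exponent is `ḡ₁` times the carry of
`ḡ₂ + ḡ₃`. -/
theorem alphaZMod_eq_pow (m : ℕ) [NeZero m] (g₁ g₂ g₃ : ZMod m) :
    alphaZMod m g₁ g₂ g₃ =
      Complex.exp (2 * Real.pi * Complex.I / m) ^ (g₁.val * ((g₂.val + g₃.val) / m)) := by
  have hm : (m : ℂ) ≠ 0 := Nat.cast_ne_zero.mpr (NeZero.ne m)
  have h : (g₂.val : ℂ) + g₃.val = ((g₂ + g₃).val : ℂ) + m * ((g₂.val + g₃.val) / m : ℕ) := by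
    rw [ZMod.val_add]
    exact_mod_cast (Nat.mod_add_div (g₂.val + g₃.val) m).symm
  rw [alphaZMod, h, ← Complex.exp_nat_mul, Nat.cast_mul]
  congr 1
  field_simp
  ring

theorem cos_two_pi_div_five : Real.cos (2 * Real.pi / 5) = (Real.sqrt 5 - 1) / 4 := by
  have h5 : Real.sqrt 5 ^ 2 = 5 := Real.sq_sqrt (by norm_num)
  rw [mul_div_assoc, Real.cos_two_mul, Real.cos_pi_div_five]
  linear_combination h5 / 8

theorem sin_two_pi_div_five :
    Real.sin (2 * Real.pi / 5) = Real.sqrt (10 + 2 * Real.sqrt 5) / 4 := by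
  have h5 : Real.sqrt 5 ^ 2 = 5 := Real.sq_sqrt (by norm_num)
  have hs : 0 ≤ Real.sin (2 * Real.pi / 5) :=
    Real.sin_nonneg_of_nonneg_of_le_pi (by positivity) (by linarith [Real.pi_pos])
  have hsq := Real.sin_sq_add_cos_sq (2 * Real.pi / 5)
  rw [cos_two_pi_div_five] at hsq
  rw [eq_div_iff (by norm_num), eq_comm, Real.sqrt_eq_iff_eq_sq (by positivity) (by positivity)]
  linear_combination -16 * hsq + h5

theorem exp_two_pi_I_div_five :
    Complex.exp (2 * Real.pi * Complex.I / (5 : ℕ)) =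
      ((Real.sqrt 5 : ℂ) - 1 + Complex.I * (Real.sqrt (10 + 2 * Real.sqrt 5) : ℂ)) / 4 := by
  have h : 2 * Real.pi * Complex.I / (5 : ℕ) = ((2 * Real.pi / 5 : ℝ) : ℂ) * Complex.I := by
    push_cast
    ring
  rw [h, Complex.exp_mul_I, ← Complex.ofReal_cos, ← Complex.ofReal_sin, cos_two_pi_div_five,
    sin_two_pi_div_five]
  push_cast
  ring

theorem stateSum_m003_eq :
    (∑ b : ZMod 5,
        (alphaZMod 5 b b b)⁻¹ * alphaZMod 5 (2 * b) b b *
          alphaZMod 5 (3 * b) (3 * b) (3 * b) * alphaZMod 5 b b (3 * b) *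
          alphaZMod 5 b (2 * b) (2 * b) * alphaZMod 5 (2 * b) (3 * b) (2 * b))
      = 3 + 2 * Complex.exp (2 * Real.pi * Complex.I / (5 : ℕ)) := by
  simp only [alphaZMod_eq_pow]
  have hω : Complex.exp (2 * Real.pi * Complex.I / (5 : ℕ)) ^ 5 = 1 :=
    (Complex.isPrimitiveRoot_exp 5 (by norm_num)).pow_eq_one
  have hω₀ := Complex.exp_ne_zero (2 * Real.pi * Complex.I / (5 : ℕ))
  generalize Complex.exp (2 * Real.pi * Complex.I / (5 : ℕ)) = ω at hω hω₀ ⊢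
  have hsum (f : ZMod 5 → ℂ) : ∑ b, f b = f 0 + f 1 + f 2 + f 3 + f 4 := Fin.sum_univ_five f
  have h₀ : (0 : ZMod 5).val = 0 := rfl
  have h₁ : (1 : ZMod 5).val = 1 := rfl
  have h₂ : (2 : ZMod 5).val = 2 := rfl
  have h₃ : (3 : ZMod 5).val = 3 := rfl
  have h₄ : (4 : ZMod 5).val = 4 := rfl
  simp only [hsum, ZMod.val_mul, h₀, h₁, h₂, h₃, h₄]
  norm_num
  field_simp
  grind

/-- The state sum computing the generalized Dijkgraaf–Witten invariant `Z(m003)` with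
`G = ℤ/5ℤ` and a generator `α = α_5` of `H³(ℤ/5ℤ, U(1)) ≅ ℤ/5ℤ` equals
`(1/2)(5 + √5 + i√(10+2√5))`; in particular it differs from `Z(m004) = 1`. -/
theorem dw_m003_ne_m004 :
    (∑ b : ZMod 5,
        (alphaZMod 5 b b b)⁻¹ * alphaZMod 5 (2 * b) b b *
          alphaZMod 5 (3 * b) (3 * b) (3 * b) * alphaZMod 5 b b (3 * b) *
          alphaZMod 5 b (2 * b) (2 * b) * alphaZMod 5 (2 * b) (3 * b) (2 * b))
      = (1 / 2) * (5 + (Real.sqrt 5 : ℂ) +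
          Complex.I * (Real.sqrt (10 + 2 * Real.sqrt 5) : ℂ)) ∧
    (∑ b : ZMod 5,
        (alphaZMod 5 b b b)⁻¹ * alphaZMod 5 (2 * b) b b *
          alphaZMod 5 (3 * b) (3 * b) (3 * b) * alphaZMod 5 b b (3 * b) *
          alphaZMod 5 b (2 * b) (2 * b) * alphaZMod 5 (2 * b) (3 * b) (2 * b)) ≠ 1 := by
  have hsum := stateSum_m003_eq
  rw [exp_two_pi_I_div_five] at hsum
  rw [hsum]
  refine ⟨by ring, fun h => ?_⟩
  have hre := congrArg Complex.re h
  simp at hre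
  linarith [Real.sqrt_nonneg 5]
end

section
/- Let α = α_12 be the cocycle α_12(g₁,g₂,g₃) = exp((2πi/144) · ḡ₁(ḡ₂ + ḡ₃ − (g₂+g₃)‾)) on ℤ/12ℤ. Then ∑_{d ∈ ℤ/12ℤ} α(d,d,2d) · α(2d,d,d) · α(2d,d,2d) · α(3d,2d,3d) · α(3d,10d,3d) · α(5d,5d,10d) · α(10d,5d,5d) · α(10d,5d,10d) = −6. -/
/-- The cocycle `α_m` is `g₁` times the carry of `g₂ + g₃`, read through the standard additive
character. -/
theorem alphaZMod_eq_stdAddChar (m : ℕ) [NeZero m] (g₁ g₂ g₃ : ZMod m) :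
    alphaZMod m g₁ g₂ g₃ = ZMod.stdAddChar (g₁ * (((g₂.val + g₃.val) / m : ℕ) : ZMod m)) := by
  have hm : (m : ℂ) ≠ 0 := NeZero.ne _
  have hcarry : (g₂.val : ℂ) + g₃.val - (g₂ + g₃).val = m * ((g₂.val + g₃.val) / m : ℕ) := by
    rw [ZMod.val_add, sub_eq_iff_eq_add]
    exact_mod_cast (Nat.div_add_mod _ _).symm
  have hcast : g₁ * (((g₂.val + g₃.val) / m : ℕ) : ZMod m) =
      (((g₁.val * ((g₂.val + g₃.val) / m) : ℕ) : ℤ) : ZMod m) := by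
    rw [Int.cast_natCast, Nat.cast_mul, ZMod.natCast_zmod_val]
  rw [hcast, ZMod.stdAddChar_coe, alphaZMod, hcarry]
  congr 1
  rw [Int.cast_natCast, Nat.cast_mul]
  field_simp

theorem ZMod.stdAddChar_six : ZMod.stdAddChar (6 : ZMod 12) = -1 := by
  have hne : ZMod.stdAddChar (6 : ZMod 12) ≠ 1 := fun h =>
    absurd (ZMod.injective_stdAddChar (h.trans (AddChar.map_zero_eq_one _).symm)) (by decide)
  have hsq : ZMod.stdAddChar (6 : ZMod 12) * ZMod.stdAddChar (6 : ZMod 12) = 1 := by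
    rw [← AddChar.map_add_eq_mul, show (6 + 6 : ZMod 12) = 0 by decide, AddChar.map_zero_eq_one]
  exact (mul_self_eq_one_iff.mp hsq).resolve_left hne

theorem ZMod.one_add_stdAddChar_four_add_stdAddChar_eight :
    1 + ZMod.stdAddChar (4 : ZMod 12) + ZMod.stdAddChar (8 : ZMod 12) = 0 := by
  have hne : ZMod.stdAddChar (4 : ZMod 12) ≠ 1 := fun h =>
    absurd (ZMod.injective_stdAddChar (h.trans (AddChar.map_zero_eq_one _).symm)) (by decide)
  have hsq : ZMod.stdAddChar (8 : ZMod 12) =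
      ZMod.stdAddChar (4 : ZMod 12) * ZMod.stdAddChar (4 : ZMod 12) := by
    rw [← AddChar.map_add_eq_mul, show (4 + 4 : ZMod 12) = 8 by decide]
  have hcube : ZMod.stdAddChar (4 : ZMod 12) * ZMod.stdAddChar (8 : ZMod 12) = 1 := by
    rw [← AddChar.map_add_eq_mul, show (4 + 8 : ZMod 12) = 0 by decide, AddChar.map_zero_eq_one]
  apply mul_left_cancel₀ (sub_ne_zero.mpr hne)
  linear_combination hcube - hsq

/-- The state sum computing the generalized Dijkgraaf–Witten invariant `Z(s778)` with
`G = ℤ/12ℤ` and a generator `α = α_12` of `H³(ℤ/12ℤ, U(1)) ≅ ℤ/12ℤ` equals `−6`. -/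
theorem dw_s778 :
    (∑ d : ZMod 12,
        alphaZMod 12 d d (2 * d) * alphaZMod 12 (2 * d) d d *
          alphaZMod 12 (2 * d) d (2 * d) * alphaZMod 12 (3 * d) (2 * d) (3 * d) *
          alphaZMod 12 (3 * d) (10 * d) (3 * d) * alphaZMod 12 (5 * d) (5 * d) (10 * d) *
          alphaZMod 12 (10 * d) (5 * d) (5 * d) * alphaZMod 12 (10 * d) (5 * d) (10 * d))
      = -6 := by
  simp only [alphaZMod_eq_stdAddChar, ← AddChar.map_add_eq_mul]
  have hphase : ∀ d : ZMod 12,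
      d * (((d.val + (2 * d).val) / 12 : ℕ) : ZMod 12) + 2 * d * (((d.val + d.val) / 12 : ℕ) : ZMod 12) +
        2 * d * (((d.val + (2 * d).val) / 12 : ℕ) : ZMod 12) +
        3 * d * ((((2 * d).val + (3 * d).val) / 12 : ℕ) : ZMod 12) +
        3 * d * ((((10 * d).val + (3 * d).val) / 12 : ℕ) : ZMod 12) +
        5 * d * ((((5 * d).val + (10 * d).val) / 12 : ℕ) : ZMod 12) +
        10 * d * ((((5 * d).val + (5 * d).val) / 12 : ℕ) : ZMod 12) +
        10 * d * ((((5 * d).val + (10 * d).val) / 12 : ℕ) : ZMod 12) =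
      (![0, 6, 8, 6, 4, 6, 0, 6, 4, 6, 8, 6] : Fin 12 → ZMod 12) d := by
    intro d
    fin_cases d <;> rfl
  simp only [hphase]
  change ∑ d : Fin 12, ZMod.stdAddChar
    ((![0, 6, 8, 6, 4, 6, 0, 6, 4, 6, 8, 6] : Fin 12 → ZMod 12) d) = -6
  simp only [Fin.sum_univ_succ, Fin.sum_univ_zero, Matrix.cons_val_zero, Matrix.cons_val_succ,
    AddChar.map_zero_eq_one, ZMod.stdAddChar_six]
  linear_combination 2 * ZMod.one_add_stdAddChar_four_add_stdAddChar_eight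
end
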